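/- For a non-degenerate best-k scoring rule and any positive integer R, for every voter i with j*(i) ≤ R and every collection A_{-i} of the other voters' ballots, there exists a best response (BR) ballot A_i with |A_i| ≤ R; that is, an R ballot-length restriction is non-constraining for every voter whose set-extension value satisfies j*(i) ≤ R. -/

import Mathlib

open Finset

/-- The 0-indexed rank of candidate `c` within committee `W` with respect to the utility `u`:
the number of members of `W` strictly preferred to `c`.  Thus the most preferred member of `W`
has rank `0`. -/
noncomputable def owaRank {C : Type*} (u : C → ℝ) (W : Finset C) (c : C) : ℕ :=
  (W.filter fun c' => u c < u c').card

/-- The OWA set-extension utility determined by the weights `lam` (where `lam 0` is the weight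
`λ₁` put on the most preferred committee member, `lam 1` is `λ₂`, and so on) and the
utility function `u`. -/
noncomputable def owaUtil {C : Type*} (lam : ℕ → ℝ) (u : C → ℝ) (W : Finset C) : ℝ :=
  ∑ c ∈ W, lam (owaRank u W c) * u c

/-- The approval score of candidate `c` under the ballot profile `A`. -/
def score {N C : Type*} [Fintype N] [DecidableEq C] (A : N → Finset C) (c : C) : ℕ :=
  (Finset.univ.filter fun i => c ∈ A i).card

/-- Candidate `c` is ranked above candidate `c'` by the best-`k` scoring rule with scoring
function `g`, with ties broken by the priority order: `c < c'` means `c` has higher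
priority (`c ▷ c'`). -/
def beats {N C : Type*} [Fintype N] [DecidableEq C] [LT C]
    (g : C → ℕ → ℝ) (A : N → Finset C) (c c' : C) : Prop :=
  g c' (score A c') < g c (score A c) ∨
    (g c (score A c) = g c' (score A c') ∧ c < c')

open Classical in
/-- The winning committee: the `k` top-ranked candidates. -/
noncomputable def winners {N C : Type*} [Fintype N] [Fintype C] [DecidableEq C] [LT C]
    (g : C → ℕ → ℝ) (k : ℕ) (A : N → Finset C) : Finset C :=
  Finset.univ.filter fun c => (Finset.univ.filter fun c' => beats g A c' c).card < k

/-- `B` is a best-response ballot of voter `i` against the other voters' ballots in `A`. -/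
def BestResponse {N C : Type*} [Fintype N] [DecidableEq N] [Fintype C] [DecidableEq C] [LT C]
    (g : C → ℕ → ℝ) (k : ℕ) (lam : ℕ → ℝ) (u : C → ℝ)
    (A : N → Finset C) (i : N) (B : Finset C) : Prop :=
  ∀ B' : Finset C,
    owaUtil lam u (winners g k (Function.update A i B')) ≤
      owaUtil lam u (winners g k (Function.update A i B))

/-- `B` is a minimal best-response ballot of voter `i`. -/
def MinimalBestResponse {N C : Type*} [Fintype N] [DecidableEq N] [Fintype C] [DecidableEq C]
    [LT C] (g : C → ℕ → ℝ) (k : ℕ) (lam : ℕ → ℝ) (u : C → ℝ)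
    (A : N → Finset C) (i : N) (B : Finset C) : Prop :=
  BestResponse g k lam u A i B ∧
    ∀ B' : Finset C, BestResponse g k lam u A i B' → B.card ≤ B'.card

/-- A ballot profile is a lazy pure Nash equilibrium if every voter's ballot is a minimal
best response to the other voters' ballots. -/
def LazyPNE {N C : Type*} [Fintype N] [DecidableEq N] [Fintype C] [DecidableEq C] [LT C]
    (g : C → ℕ → ℝ) (k : ℕ) (lam : N → ℕ → ℝ) (u : N → C → ℝ) (A : N → Finset C) : Prop :=
  ∀ i, MinimalBestResponse g k (lam i) (u i) A i (A i)

/-- A ballot is sincere if every approved candidate is preferred to every unapproved one. -/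
def Sincere {C : Type*} (u : C → ℝ) (B : Finset C) : Prop :=
  ∀ c ∈ B, ∀ c' ∉ B, u c' < u c

/-- In a finite set strictly and totally ordered by `r`, the ranks of the elements are exactly
`0, …, #s - 1`. -/
theorem image_card_filter_eq_range {α : Type*} (r : α → α → Prop) [DecidableRel r] (s : Finset α)
    (hirr : ∀ a, ¬ r a a) (htrans : ∀ a b c, r a b → r b c → r a c)
    (htri : ∀ a b, a ≠ b → r a b ∨ r b a) :
    s.image (fun c => #{x ∈ s | r x c}) = range #s := by
  have hlt : ∀ a ∈ s, ∀ b, r a b → #{x ∈ s | r x a} < #{x ∈ s | r x b} := by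
    intro a ha b hab
    refine card_lt_card ((ssubset_iff_of_subset ?_).2 ⟨a, by simp [ha, hab], by simp [hirr]⟩)
    intro x hx
    simp only [mem_filter] at hx ⊢
    exact ⟨hx.1, htrans _ _ _ hx.2 hab⟩
  refine eq_of_subset_of_card_le ?_ ?_
  · intro n hn
    obtain ⟨c, hc, rfl⟩ := mem_image.1 hn
    exact mem_range.2 (card_lt_card (filter_ssubset.2 ⟨c, hc, hirr c⟩))
  · rw [card_range, card_image_of_injOn]
    intro a ha b hb hab
    by_contra hne
    rcases htri a b hne with h | h
    · exact (hlt a ha b h).ne hab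
    · exact (hlt b hb a h).ne hab.symm

theorem image_owaRank {C : Type*} {u : C → ℝ} (hu : Function.Injective u) (W : Finset C) :
    W.image (owaRank u W) = range #W :=
  image_card_filter_eq_range (fun x c => u c < u x) W (fun _ => lt_irrefl _)
    (fun _ _ _ h₁ h₂ => h₂.trans h₁) fun _ _ h => (hu.ne h).lt_or_gt.symm

theorem owaRank_injOn {C : Type*} {u : C → ℝ} (hu : Function.Injective u) (W : Finset C) :
    Set.InjOn (owaRank u W) W := by
  rw [← card_image_iff, image_owaRank hu, card_range]

theorem owaRank_lt_of_lt {C : Type*} {u : C → ℝ} {W : Finset C} {a b : C} (ha : a ∈ W)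
    (h : u b < u a) : owaRank u W a < owaRank u W b := by
  refine card_lt_card ((ssubset_iff_of_subset ?_).2 ⟨a, by simp [ha, h], by simp⟩)
  intro x hx
  simp only [mem_filter] at hx ⊢
  exact ⟨hx.1, h.trans hx.2⟩

/-- If the weights vanish from position `j` on, the OWA utility is the weighted sum over the `j`
best members, listed by `e`. -/
theorem owaUtil_eq_sum_range {C : Type*} {u : C → ℝ} (hu : Function.Injective u) {lam : ℕ → ℝ}
    {j : ℕ} (hz : ∀ n, j ≤ n → lam n = 0) (W : Finset C) (e : ℕ → C)
    (he : ∀ n < j, e n ∈ W ∧ owaRank u W (e n) = n) :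
    owaUtil lam u W = ∑ n ∈ range j, lam n * u (e n) := by
  have hfilter : ∑ c ∈ W with owaRank u W c < j, lam (owaRank u W c) * u c = owaUtil lam u W := by
    refine sum_filter_of_ne fun c _ hne => ?_
    by_contra hlt
    exact hne (by rw [hz _ (not_lt.1 hlt), zero_mul])
  rw [← hfilter]
  have hinv : ∀ c ∈ W, owaRank u W c < j → e (owaRank u W c) = c := fun c hc hcj =>
    owaRank_injOn hu W (he _ hcj).1 hc (he _ hcj).2
  refine sum_nbij' (owaRank u W) e ?_ ?_ ?_ ?_ ?_
  · intro c hc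
    exact mem_range.2 (mem_filter.1 hc).2
  · intro n hn
    have hnj := mem_range.1 hn
    exact mem_filter.2 ⟨(he n hnj).1, by rwa [(he n hnj).2]⟩
  · intro c hc
    exact hinv c (mem_filter.1 hc).1 (mem_filter.1 hc).2
  · intro n hn
    exact (he n (mem_range.1 hn)).2
  · intro c hc
    rw [hinv c (mem_filter.1 hc).1 (mem_filter.1 hc).2]

theorem exists_owaRank_listing {C : Type*} {u : C → ℝ} (hu : Function.Injective u) {j : ℕ}
    {W : Finset C} (hj : 1 ≤ j) (hW : j ≤ #W) :
    ∃ e : ℕ → C, ∀ n < j, e n ∈ W ∧ owaRank u W (e n) = n := by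
  have hex : ∀ n < j, ∃ c, c ∈ W ∧ owaRank u W c = n := fun n hn =>
    mem_image.1 (image_owaRank hu W ▸ mem_range.2 (hn.trans_le hW))
  have : Nonempty C := ⟨(hex 0 hj).choose⟩
  exact ⟨fun n => Classical.epsilon fun c => c ∈ W ∧ owaRank u W c = n,
    fun n hn => Classical.epsilon_spec (hex n hn)⟩

/-- Keeping the `j` best members of a committee does not decrease the OWA utility when the
weights vanish from position `j` on. -/
theorem owaUtil_le_of_top_subset {C : Type*} {u : C → ℝ} (hu : Function.Injective u) {lam : ℕ → ℝ}
    (hlam : ∀ n, 0 ≤ lam n) {j : ℕ} (hj : 1 ≤ j) (hz : ∀ n, j ≤ n → lam n = 0) {W W' : Finset C}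
    (hW : j ≤ #W) (hW' : j ≤ #W') (hsub : ∀ c ∈ W, owaRank u W c < j → c ∈ W') :
    owaUtil lam u W ≤ owaUtil lam u W' := by
  obtain ⟨e, he⟩ := exists_owaRank_listing hu hj hW
  obtain ⟨e', he'⟩ := exists_owaRank_listing hu hj hW'
  rw [owaUtil_eq_sum_range hu hz W e he, owaUtil_eq_sum_range hu hz W' e' he']
  refine sum_le_sum fun n hn => mul_le_mul_of_nonneg_left ?_ (hlam n)
  have hnj := mem_range.1 hn
  obtain ⟨hmem, hrank⟩ := he n hnj
  obtain ⟨-, hrank'⟩ := he' n hnj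
  by_contra! hlt
  have hle : owaRank u W (e n) ≤ owaRank u W' (e n) := by
    refine card_le_card fun x hx => ?_
    simp only [mem_filter] at hx ⊢
    exact ⟨hsub x hx.1 (((owaRank_lt_of_lt hx.1 hx.2).trans_eq hrank).trans hnj), hx.2⟩
  have := owaRank_lt_of_lt (hsub _ hmem (hrank.trans_lt hnj)) hlt
  omega

theorem card_winners {N C : Type*} [Fintype N] [Fintype C] [LinearOrder C] (g : C → ℕ → ℝ)
    {k : ℕ} (hk : k ≤ Fintype.card C) (A : N → Finset C) : #(winners g k A) = k := by
  classical
  have himage := image_card_filter_eq_range (beats g A) univ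
    (fun a h => by simp [beats] at h)
    (fun a b c hab hbc => by
      rcases hab with hab | ⟨hab, hab'⟩ <;> rcases hbc with hbc | ⟨hbc, hbc'⟩
      · exact Or.inl (hbc.trans hab)
      · exact Or.inl (hbc ▸ hab)
      · exact Or.inl (hab ▸ hbc)
      · exact Or.inr ⟨hab.trans hbc, hab'.trans hbc'⟩)
    (fun a b hne => by
      rcases lt_trichotomy (g a (score A a)) (g b (score A b)) with h | h | h
      · exact Or.inr (Or.inl h)
      · exact hne.lt_or_gt.imp (fun h' => Or.inr ⟨h, h'⟩) fun h' => Or.inr ⟨h.symm, h'⟩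
      · exact Or.inl (Or.inl h))
  have hinj : Set.InjOn (fun c => #{x | beats g A x c}) (univ : Finset C) := by
    rw [← card_image_iff, himage, card_range]
  have hwin : (winners g k A).image (fun c => #{x | beats g A x c}) = range k := by
    ext n
    simp only [winners, mem_image, mem_filter, mem_univ, true_and, mem_range]
    constructor
    · rintro ⟨c, hc, rfl⟩
      convert hc
    · intro hn
      have hmem : n ∈ range #(univ : Finset C) := mem_range.2 (hn.trans_le hk)
      rw [← himage] at hmem
      obtain ⟨c, -, hc⟩ := mem_image.1 hmem
      exact ⟨c, by convert hc.trans_lt hn, hc⟩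
  rw [← card_image_of_injOn (hinj.mono (by simp)), hwin, card_range]

theorem score_mono {N C : Type*} [Fintype N] [DecidableEq C] {A A' : N → Finset C} {c : C}
    (h : ∀ j, c ∈ A j → c ∈ A' j) : score A c ≤ score A' c :=
  card_le_card (monotone_filter_right _ fun j _ => h j)

/-- A winner whose score is kept still wins when no other candidate gains approvals. -/
theorem mem_winners_of_score_le {N C : Type*} [Fintype N] [Fintype C] [LinearOrder C]
    {g : C → ℕ → ℝ} (hg : ∀ c, Monotone (g c)) {k : ℕ} {A A' : N → Finset C} {c : C}
    (hc : c ∈ winners g k A) (hscore : score A c ≤ score A' c)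
    (hle : ∀ x, score A' x ≤ score A x) : c ∈ winners g k A' := by
  classical
  simp only [winners, mem_filter, mem_univ, true_and] at hc ⊢
  refine (card_le_card (monotone_filter_right _ fun x _ hx => ?_)).trans_lt hc
  have hcx := hg c hscore
  have hxx := hg x (hle x)
  rcases hx with hx | ⟨hx, hx'⟩
  · exact Or.inl (by linarith)
  · rcases hxx.lt_or_eq with h | h
    · exact Or.inl (by linarith)
    · rcases hcx.lt_or_eq with h' | h'
      · exact Or.inl (by linarith)
      · exact Or.inr ⟨by linarith, hx'⟩

/-- if `j*(i) ≤ R` then there exists a best-response ballot of length at most `R`;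
an `R` ballot-length restriction is non-constraining for such a voter. -/
theorem statement_6 {N C : Type*} [Fintype N] [DecidableEq N] [Fintype C] [LinearOrder C]
    (k : ℕ) (hk1 : 1 ≤ k) (hk2 : k ≤ Fintype.card C)
    (g : C → ℕ → ℝ) (hg : ∀ c, StrictMono (g c)) (hg0 : ∀ c, g c 0 = 0)
    (u : C → ℝ) (hu : Function.Injective u)
    (lam : ℕ → ℝ) (hlam : ∀ n, 0 ≤ lam n)
    (jstar : ℕ) (hj1 : 1 ≤ jstar) (hjk : jstar ≤ k)
    (hz : ∀ n, jstar ≤ n → lam n = 0) (hpos : 0 < lam (jstar - 1))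
    (R : ℕ) (hR1 : 1 ≤ R) (hjR : jstar ≤ R)
    (A : N → Finset C) (i : N) :
    ∃ B : Finset C, B.card ≤ R ∧ BestResponse g k lam u A i B := by
  classical
  obtain ⟨B, hB⟩ := Finite.exists_max
    fun B : Finset C => owaUtil lam u (winners g k (Function.update A i B))
  set W := winners g k (Function.update A i B)
  set T := {c ∈ W | owaRank u W c < jstar}
  refine ⟨B ∩ T, ?_, fun B' => (hB B').trans ?_⟩
  · calc #(B ∩ T) ≤ #T := card_le_card inter_subset_right
      _ ≤ #(range jstar) := card_le_card_of_injOn (owaRank u W)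
          (fun c hc => by simpa using (mem_filter.1 hc).2)
          ((owaRank_injOn hu W).mono (coe_subset.2 (filter_subset _ _)))
      _ ≤ R := by simpa using hjR
  · refine owaUtil_le_of_top_subset hu hlam hj1 hz (hjk.trans_eq (card_winners g hk2 _).symm)
      (hjk.trans_eq (card_winners g hk2 _).symm) fun c hc hrank =>
        mem_winners_of_score_le (fun c => (hg c).monotone) hc (score_mono fun j hj => ?_)
          fun x => score_mono fun j hj => ?_
    · rcases eq_or_ne j i with rfl | hne
      · simp only [Function.update_self] at hj ⊢
        exact mem_inter.2 ⟨hj, mem_filter.2 ⟨hc, hrank⟩⟩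
      · simpa [hne] using hj
    · rcases eq_or_ne j i with rfl | hne
      · simp only [Function.update_self] at hj ⊢
        exact (mem_inter.1 hj).1
      · simpa [hne] using hj
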